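/- arXiv:1605.08998 — 2 statements merged into one kernel-verified Lean document; each statement's English description precedes it below -/
import Mathlib

section
/- Let F be a field, let m ≥ n ≥ 1 and t ≥ 1 be integers, and let E be an n × m matrix over F such that (i) the leftmost n × n submatrix of E (columns 1,…,n) is the identity matrix I_n, and (ii) every n cyclically adjacent columns of E are linearly independent (for every k ∈ ℤ/mℤ, columns k, k+1, …, k+n−1 of E, indices modulo m, are linearly independent). Let M be the (tm + n) × m matrix obtained by vertically stacking t copies of the m × m identity matrix I_m followed by E at the bottom. Then every m cyclically adjacent rows of M are linearly independent: for every k ∈ ℤ/(tm+n)ℤ, the rows of M with indices k, k+1, …, k+m−1 (taken modulo tm+n) are linearly independent over F. -/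
/-- A vector orthogonal to `n` linearly independent vectors of `F ^ n` is zero. -/
lemma eq_zero_of_dotProduct_linearIndependent {F ι κ : Type*} [Field F] [Fintype ι] [Fintype κ]
    (b : κ → ι → F) (hb : LinearIndependent F b) (hcard : Fintype.card κ = Fintype.card ι)
    (v : ι → F) (hv : ∀ s, v ⬝ᵥ b s = 0) : v = 0 := by
  have hspan : Submodule.span F (Set.range b) = ⊤ :=
    hb.span_eq_top_of_card_eq_finrank' (by simpa using hcard)
  have hker : Submodule.span F (Set.range b) ≤ LinearMap.ker (dotProductBilin F F v) := by
    rw [Submodule.span_le]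
    rintro _ ⟨s, rfl⟩
    exact hv s
  refine dotProduct_eq_zero v fun w => ?_
  exact hker (hspan ▸ Submodule.mem_top : w ∈ _)

lemma Nat.eq_of_mod_eq_of_lt_add {m x y : ℕ} (h : x % m = y % m) (hxy : x < y + m)
    (hyx : y < x + m) : x = y := by
  have hdvd : (m : ℤ) ∣ (x : ℤ) - y := (Nat.modEq_iff_dvd.mp (Eq.symm h : y ≡ x [MOD m]))
  have := Int.eq_zero_of_abs_lt_dvd hdvd (by rw [abs_lt]; omega)
  omega

lemma ZMod.val_add_natCast {N : ℕ} [NeZero N] (k : ZMod N) {s : ℕ} (hs : s < N) :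
    (k + (s : ZMod N)).val = if k.val + s < N then k.val + s else k.val + s - N := by
  have hk := k.val_lt
  rw [ZMod.val_add, ZMod.val_natCast_of_lt hs]
  split_ifs with h
  · exact Nat.mod_eq_of_lt h
  · rw [Nat.mod_eq_sub_mod (by omega), Nat.mod_eq_of_lt (by omega)]

/-- Induction step of the CONSTRUCTION (row version): if `E` is an `n × m` matrix
whose leftmost `n × n` block is the identity and whose every `n` cyclically adjacent
columns are linearly independent, then in the `(t*m + n) × m` matrix `M` obtained by
stacking `t` copies of `I_m` on top of `E`, every `m` cyclically adjacent rows are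
linearly independent. -/
theorem construction_step_adjacent_rows_linearIndependent
    (F : Type*) [Field F] (m n t : ℕ) (hn : 0 < n) (hnm : n ≤ m) (ht : 1 ≤ t)
    (E : Matrix (ZMod n) (ZMod m) F)
    (hleft : ∀ i j : ZMod n, E i ((j.val : ZMod m)) = if i = j then 1 else 0)
    (hcols : ∀ k : ZMod m,
      LinearIndependent F (fun s : Fin n => E.transpose (k + (s.val : ZMod m))))
    (M : Matrix (ZMod (t * m + n)) (ZMod m) F)
    (hM1 : ∀ (i : ZMod (t * m + n)) (j : ZMod m), i.val < t * m →
      M i j = if i.val % m = j.val then 1 else 0)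
    (hM2 : ∀ (i : ZMod (t * m + n)) (j : ZMod m), t * m ≤ i.val →
      M i j = E ((i.val - t * m : ℕ) : ZMod n) j) :
    ∀ k : ZMod (t * m + n),
      LinearIndependent F
        (fun s : Fin m => M (k + (s.val : ZMod (t * m + n)))) := by
  intro k
  obtain ⟨t, rfl⟩ : ∃ u, t = u + 1 := ⟨t - 1, by omega⟩
  have : NeZero n := ⟨by omega⟩
  have : NeZero m := ⟨by omega⟩
  have : NeZero ((t + 1) * m + n) := ⟨by omega⟩
  rw [Fintype.linearIndependent_iff]
  intro g hg
  obtain ⟨T, hT⟩ : ∃ T, T = t * m := ⟨_, rfl⟩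
  have hTm : (t + 1) * m = T + m := by rw [hT]; ring
  obtain ⟨a, ha⟩ : ∃ a, a = k.val := ⟨_, rfl⟩
  have haN : a < T + m + n := by
    have := k.val_lt
    omega
  obtain ⟨row, hrow⟩ : ∃ row : Fin m → ℕ,
      ∀ s, row s = (k + ((s : ℕ) : ZMod ((t + 1) * m + n))).val := ⟨_, fun _ => rfl⟩
  have hrow' : ∀ s : Fin m,
      row s = if a + s < T + m + n then a + s.val else a + s.val - (T + m + n) := by
    intro s
    have := s.isLt
    rw [hrow, ZMod.val_add_natCast k (by omega), ← ha, hTm]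
  have hM1' : ∀ s j, row s < T + m → M (k + ((s : ℕ) : ZMod ((t + 1) * m + n))) j =
      if row s % m = j.val then 1 else 0 := by
    intro s j h
    rw [hrow] at h ⊢
    exact hM1 _ j (by omega)
  have hM2' : ∀ s j, T + m ≤ row s → M (k + ((s : ℕ) : ZMod ((t + 1) * m + n))) j =
      E ((row s - (T + m) : ℕ) : ZMod n) j := by
    intro s j h
    rw [hrow] at h ⊢
    rw [hM2 _ j (by omega)]
    congr 2
    omega
  have hrowlt : ∀ s, row s < T + m + n := by
    intro s
    have := s.isLt
    rw [hrow' s]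
    split_ifs <;> omega
  have hrowinj : ∀ s s', row s = row s' → s = s' := by
    intro s s' h
    have := s.isLt
    have := s'.isLt
    rw [hrow' s, hrow' s'] at h
    ext
    split_ifs at h <;> omega
  have hmodT : ∀ x, (x + T) % m = x % m := fun x => by
    rw [hT, Nat.add_mul_mod_self_right]
  have hmodinj : ∀ s s', row s < T + m → row s' < T + m → row s % m = row s' % m → s = s' := by
    have hmixed : ∀ s s' : Fin m, a + s.val < T + m → T + m + n ≤ a + s'.val →
        (a + s.val) % m ≠ (a + s'.val - (T + m + n)) % m := by
      intro s s' hs hs' h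
      have := s.isLt
      have := s'.isLt
      rw [← Nat.add_mod_right (a + s'.val - (T + m + n)),
        ← hmodT (a + s'.val - (T + m + n) + m)] at h
      have := Nat.eq_of_mod_eq_of_lt_add h (by omega) (by omega)
      omega
    intro s s' hs hs' h
    have := s.isLt
    have := s'.isLt
    rw [hrow' s] at h hs
    rw [hrow' s'] at h hs'
    ext
    split_ifs at h hs hs'
    · have := Nat.eq_of_mod_eq_of_lt_add h (by omega) (by omega)
      omega
    · exact absurd h (hmixed s s' (by omega) (by omega))
    · exact absurd h.symm (hmixed s' s (by omega) (by omega))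
    · have := Nat.eq_of_mod_eq_of_lt_add h (by omega) (by omega)
      omega
  -- `v` collects the coefficients of the rows of `E`, `w` those of the identity rows.
  obtain ⟨v, hv⟩ : ∃ v : ZMod n → F,
      ∀ i, v i = ∑ s, if row s = T + m + i.val then g s else 0 := ⟨_, fun _ => rfl⟩
  obtain ⟨w, hw⟩ : ∃ w : ZMod m → F,
      ∀ j, w j = ∑ s, if row s < T + m ∧ row s % m = j.val then g s else 0 := ⟨_, fun _ => rfl⟩
  have hsum : ∀ j, w j + ∑ i, v i * E i j = 0 := by
    intro j
    have h := congrFun hg j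
    simp only [Finset.sum_apply, Pi.smul_apply, smul_eq_mul, Pi.zero_apply] at h
    rw [← h, hw]
    simp only [hv, Finset.sum_mul]
    rw [Finset.sum_comm, ← Finset.sum_add_distrib]
    refine Finset.sum_congr rfl fun s _ => ?_
    rcases lt_or_ge (row s) (T + m) with hs | hs
    · rw [hM1' s j hs, Finset.sum_eq_zero]
      · simp [hs]
      · intro i _
        rw [if_neg (by omega), zero_mul]
    · have hlt := hrowlt s
      have hval : ((row s - (T + m) : ℕ) : ZMod n).val = row s - (T + m) :=
        ZMod.val_natCast_of_lt (by omega)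
      rw [hM2' s j hs, if_neg (by omega), zero_add,
        Finset.sum_eq_single ((row s - (T + m) : ℕ) : ZMod n)]
      · rw [if_pos (by omega)]
      · intro i _ hi
        rw [if_neg, zero_mul]
        intro h
        apply hi
        rw [h, Nat.add_sub_cancel_left, ZMod.natCast_zmod_val]
      · simp
  have hvzero : ∀ i, (∀ s, row s ≠ T + m + i.val) → v i = 0 := fun i hi => by
    rw [hv]
    exact Finset.sum_eq_zero fun s _ => if_neg (hi s)
  have hwzero : ∀ j, (∀ s, row s < T + m → row s % m ≠ j.val) → w j = 0 := fun j hj => by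
    rw [hw]
    exact Finset.sum_eq_zero fun s _ => if_neg fun h => hj s h.1 h.2
  have hleft' : ∀ j : ZMod n, ∑ i, v i * E i (j.val : ZMod m) = v j := by
    intro j
    simp only [hleft]
    simp
  have hvalcast : ∀ x, x < m → ((x : ℕ) : ZMod m).val = x := fun x hx =>
    ZMod.val_natCast_of_lt hx
  have hwgap : T < a → ∀ x, x < m → x + T < a → a ≤ x + n + T → w (x : ZMod m) = 0 := by
    intro hTa x hxm hxa hax
    refine hwzero _ fun s hs h => ?_
    have := s.isLt
    rw [hvalcast x hxm] at h
    rw [hrow' s] at h hs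
    split_ifs at h hs
    · rw [show a + s.val = (a + s.val - T) + T by omega, hmodT, Nat.mod_eq_of_lt (by omega)] at h
      omega
    · rw [Nat.mod_eq_of_lt (by omega)] at h
      omega
  have hv0 : v = 0 := by
    rcases le_or_gt a T with haT | hTa
    · funext i
      refine hvzero i fun s h => ?_
      have := s.isLt
      rw [hrow' s] at h
      split_ifs at h <;> omega
    rcases le_or_gt a (T + n) with har | hra
    · funext i
      have hi := i.val_lt
      by_cases hir : i.val + T < a
      · have h := hsum (i.val : ZMod m)
        rwa [hwgap hTa _ (by omega) hir (by omega), hleft', zero_add] at h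
      · refine hvzero i fun s h => ?_
        have := s.isLt
        rw [hrow' s] at h
        split_ifs at h <;> omega
    · refine eq_zero_of_dotProduct_linearIndependent _ (hcols ((a - T - n : ℕ) : ZMod m))
        (by simp [ZMod.card]) v fun u => ?_
      have hu := u.isLt
      change ∑ i, v i * E i _ = 0
      rw [← Nat.cast_add]
      by_cases hum : a - T - n + u.val < m
      · have h := hsum ((a - T - n + u.val : ℕ) : ZMod m)
        rwa [hwgap hTa _ hum (by omega) (by omega), zero_add] at h
      · obtain ⟨x, hx⟩ : ∃ x, a - T - n + u.val = x + m := ⟨_, (Nat.sub_add_cancel (by omega)).symm⟩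
        have hxval : ((x : ℕ) : ZMod n).val = x := ZMod.val_natCast_of_lt (by omega)
        have h := hleft' (x : ZMod n)
        rw [hxval] at h
        rw [hx, Nat.cast_add, ZMod.natCast_self, add_zero, h]
        refine hvzero _ fun s h => ?_
        have := s.isLt
        rw [hxval, hrow' s] at h
        split_ifs at h <;> omega
  intro s
  rcases lt_or_ge (row s) (T + m) with hs | hs
  · have hval := hvalcast (row s % m) (Nat.mod_lt _ (by omega))
    have h := hsum ((row s % m : ℕ) : ZMod m)
    simp only [hv0, Pi.zero_apply, zero_mul, Finset.sum_const_zero, add_zero] at h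
    rw [hw, Finset.sum_eq_single s, if_pos ⟨hs, hval.symm⟩] at h
    · exact h
    · intro s' _ hne
      rw [hval, if_neg]
      exact fun h' => hne (hmodinj s' s h'.1 hs h'.2)
    · simp
  · have hlt := hrowlt s
    have hval : ((row s - (T + m) : ℕ) : ZMod n).val = row s - (T + m) :=
      ZMod.val_natCast_of_lt (by omega)
    have h := hv ((row s - (T + m) : ℕ) : ZMod n)
    rw [hv0, Pi.zero_apply, Finset.sum_eq_single s, if_pos (by omega)] at h
    · exact h.symm
    · intro s' _ hne
      rw [if_neg]
      exact fun h' => hne (hrowinj s' s (by omega))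
    · simp
end

section
/- Let F be a field and let K, D be positive integers with D ≤ K−1. Let L be a K × (K−D) matrix over F with rows indexed by ℤ/Kℤ such that every K−D cyclically adjacent rows of L are linearly independent. Then for every choice of per-receiver shifts t : ℤ/Kℤ → {0, 1, …, K−D−1}, the matrix L is a valid encoding matrix for the (possibly asymmetric) consecutive one-sided side-information problem: for every k ∈ ℤ/Kℤ and all message vectors x, x' ∈ F^K, if x_i = x'_i for every i ∈ {k+t(k)+1, k+t(k)+2, …, k+t(k)+D} (indices modulo K) and x·L = x'·L, then x_k = x'_k. -/
/-- Every residue modulo `K` lies within `K` steps after any given starting point. -/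
theorem ZMod.exists_lt_eq_add_natCast {K : ℕ} [NeZero K] (c i : ZMod K) :
    ∃ m < K, i = c + (m : ZMod K) :=
  ⟨(i - c).val, ZMod.val_lt _, by rw [ZMod.natCast_zmod_val]; ring⟩

/-- A vector in the left kernel of `L` that vanishes on `D` cyclically consecutive indices is zero,
provided the rows of `L` at the remaining `n` indices are linearly independent. -/
theorem Matrix.eq_zero_of_vecMul_eq_zero_of_window {F m : Type*} [Field F] {K D n : ℕ} [NeZero K]
    (hK : D + n = K) (L : Matrix (ZMod K) m F) (c : ZMod K)
    (hLI : LinearIndependent F (fun s : Fin n => L (c + (D : ZMod K) + (s.val : ZMod K))))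
    (y : ZMod K → F) (hy : ∀ i < D, y (c + (i : ZMod K)) = 0)
    (hyL : Matrix.vecMul y L = 0) : y = 0 := by
  set e : Fin n → ZMod K := fun s => c + (D : ZMod K) + (s.val : ZMod K) with he
  have cover (i : ZMod K) : y i = 0 ∨ ∃ s, e s = i := by
    obtain ⟨m, hm, rfl⟩ := ZMod.exists_lt_eq_add_natCast c i
    by_cases hmD : m < D
    · exact Or.inl (hy m hmD)
    · refine Or.inr ⟨⟨m - D, by omega⟩, ?_⟩
      simp only [he]
      rw [Nat.cast_sub (by omega)]
      ring
  have e_inj : Function.Injective e := by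
    have hinj : Function.Injective fun s : Fin n => L (e s) := hLI.injective
    exact fun a b hab => hinj (congrArg L hab)
  have hsum : ∑ s, y (e s) • L (e s) = 0 := by
    rw [Fintype.sum_of_injective e e_inj (fun s => y (e s) • L (e s)) (fun i => y i • L i)
      (fun i hi => by simp [(cover i).resolve_right hi]) (fun _ => rfl), ← hyL,
      Matrix.vecMul_eq_sum]
  have hwin := Fintype.linearIndependent_iff.mp hLI (fun s => y (e s)) hsum
  funext i
  rcases cover i with h | ⟨s, rfl⟩
  · exact h
  · exact hwin s

/-- A `K × (K-D)` matrix whose every `K - D` cyclically adjacent rows are linearly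
independent is a valid encoding matrix for the (possibly asymmetric) consecutive
one-sided side-information problem, for every choice of per-receiver shifts
`t : ZMod K → {0, …, K-D-1}`. -/
theorem adjacent_rows_linearIndependent_encodes_asymmetric_consecutive_sideInfo
    (F : Type*) [Field F] (K D : ℕ) [NeZero K] (hD : 1 ≤ D) (hDK : D ≤ K - 1)
    (L : Matrix (ZMod K) (Fin (K - D)) F)
    (hLI : ∀ k : ZMod K,
      LinearIndependent F (fun s : Fin (K - D) => L (k + (s.val : ZMod K)))) :
    ∀ t : ZMod K → ℕ, (∀ k, t k ≤ K - D - 1) →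
      ∀ k : ZMod K, ∀ x x' : ZMod K → F,
        (∀ i : Fin D,
          x (k + (t k : ZMod K) + 1 + (i.val : ZMod K)) =
            x' (k + (t k : ZMod K) + 1 + (i.val : ZMod K))) →
        Matrix.vecMul x L = Matrix.vecMul x' L → x k = x' k := by
  intro t _ k x x' hside hcode
  have hzero : x - x' = 0 := by
    refine Matrix.eq_zero_of_vecMul_eq_zero_of_window (D := D) (by omega) L
      (k + (t k : ZMod K) + 1) (hLI _) _ (fun i hi => ?_) ?_
    · exact sub_eq_zero.mpr (hside ⟨i, hi⟩)
    · rw [Matrix.sub_vecMul, hcode, sub_self]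
  exact congrFun (sub_eq_zero.mp hzero) k
end
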